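/- Let S be a finite thick generalized quadrangle of order (s,t). Assume that for each point x an elementary abelian r-group E(x) of symmetries with center x of fixed order r^m (r prime, m ≥ 1) is given, set G = ⟨E(x) : x a point⟩, and assume E(x)^g = E(x^g) for every point x and every g ∈ G. Then for each point p, the stabilizer G_p of p in G contains an elementary abelian r-subgroup H with |H| ≥ (r^m − 1)(s+1) + 1 whose elements commute with all elements of E(p), and moreover |G| < |G_p|². -/

import Mathlib

open Equiv

section GQDefs

variable {P L : Type*}

/-- A generalized quadrangle of order `(s,t)`: every line has `s+1` points, every point is
on `t+1` lines, two distinct points are on at most one common line, and for every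
non-incident point-line pair `(p, ℓ)` there is a unique pair `(q, M)` with `M` a line
through `p` and `q` a point incident with both `M` and `ℓ`. -/
structure IsGQ (I : P → L → Prop) (s t : ℕ) : Prop where
  point_count : ∀ ℓ : L, Nat.card {p : P // I p ℓ} = s + 1
  line_count : ∀ p : P, Nat.card {ℓ : L // I p ℓ} = t + 1
  unique_line : ∀ ⦃p q : P⦄, p ≠ q → ∀ ⦃ℓ m : L⦄, I p ℓ → I q ℓ → I p m → I q m → ℓ = m
  quad : ∀ ⦃p : P⦄ ⦃ℓ : L⦄, ¬ I p ℓ →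
    ∃! qM : P × L, I p qM.2 ∧ I qM.1 qM.2 ∧ I qM.1 ℓ

/-- Two points are collinear if some line is incident with both. -/
def Coll (I : P → L → Prop) (x y : P) : Prop := ∃ ℓ : L, I x ℓ ∧ I y ℓ

/-- The automorphism group of an incidence structure, as a subgroup of
`Perm P × Perm L`: pairs of permutations preserving incidence. -/
def autGroup (I : P → L → Prop) : Subgroup (Perm P × Perm L) where
  carrier := {g | ∀ p ℓ, I (g.1 p) (g.2 ℓ) ↔ I p ℓ}
  one_mem' := fun _ _ => Iff.rfl
  mul_mem' := fun {a b} ha hb p ℓ => (ha (b.1 p) (b.2 ℓ)).trans (hb p ℓ)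
  inv_mem' := by
    intro a ha p ℓ
    have h := ha (a⁻¹.1 p) (a⁻¹.2 ℓ)
    simpa using h.symm

/-- The full group `Ẽ(p)` of symmetries with center `p`: automorphisms fixing every
point collinear with `p`. -/
def symmGroup (I : P → L → Prop) (p : P) : Subgroup (Perm P × Perm L) where
  carrier := {g | g ∈ autGroup I ∧ ∀ y : P, Coll I p y → g.1 y = y}
  one_mem' := ⟨(autGroup I).one_mem, fun _ _ => rfl⟩
  mul_mem' := by
    rintro a b ⟨ha, ha'⟩ ⟨hb, hb'⟩
    refine ⟨(autGroup I).mul_mem ha hb, fun y hy => ?_⟩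
    have : (a * b).1 y = a.1 (b.1 y) := rfl
    rw [this, hb' y hy, ha' y hy]
  inv_mem' := by
    rintro a ⟨ha, ha'⟩
    refine ⟨(autGroup I).inv_mem ha, fun y hy => ?_⟩
    have h : a⁻¹.1 (a.1 y) = y := by simp
    rw [ha' y hy] at h
    exact h

/-- `x^⊥`: the set of points collinear with `x` (including `x` itself). -/
def perpSet (I : P → L → Prop) (x : P) : Set P := {y | Coll I x y}

/-- The hyperbolic line `{x,y}^{⊥⊥}`: points collinear with every point of
`{x,y}^⊥ = x^⊥ ∩ y^⊥`. -/
def hypLine (I : P → L → Prop) (x y : P) : Set P :=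
  {z | ∀ w ∈ perpSet I x ∩ perpSet I y, Coll I z w}

/-- The group `G` generated by all the point-symmetries of the quadrangle. -/
def bigGroup (I : P → L → Prop) : Subgroup (Perm P × Perm L) :=
  ⨆ x : P, symmGroup I x

/-- The set `P_r` of `r`-points: points whose full group of symmetries has order
divisible by `r`. -/
def Pr (I : P → L → Prop) (r : ℕ) : Set P :=
  {y | r ∣ Nat.card (symmGroup I y)}

/-- The set `L_r` of lines incident with at least two points of `P_r`. -/
def Lr (I : P → L → Prop) (r : ℕ) : Set L :=
  {ℓ | ∃ x y : P, x ≠ y ∧ x ∈ Pr I r ∧ y ∈ Pr I r ∧ I x ℓ ∧ I y ℓ}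

/-- The stabilizer `G_u` of a point `u` in a group `G` of automorphisms. -/
def stabPt (G : Subgroup (Perm P × Perm L)) (u : P) : Subgroup (Perm P × Perm L) where
  carrier := {g | g ∈ G ∧ g.1 u = u}
  one_mem' := ⟨G.one_mem, rfl⟩
  mul_mem' := by
    rintro a b ⟨ha, ha'⟩ ⟨hb, hb'⟩
    refine ⟨G.mul_mem ha hb, ?_⟩
    have : (a * b).1 u = a.1 (b.1 u) := rfl
    rw [this, hb', ha']
  inv_mem' := by
    rintro a ⟨ha, ha'⟩
    refine ⟨G.inv_mem ha, ?_⟩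
    have h : a⁻¹.1 (a.1 u) = u := by simp
    rw [ha'] at h
    exact h

/-- The setwise stabilizer `G_ℓ` of a line `ℓ` in a group `G` of automorphisms. -/
def stabLine (G : Subgroup (Perm P × Perm L)) (ℓ : L) : Subgroup (Perm P × Perm L) where
  carrier := {g | g ∈ G ∧ g.2 ℓ = ℓ}
  one_mem' := ⟨G.one_mem, rfl⟩
  mul_mem' := by
    rintro a b ⟨ha, ha'⟩ ⟨hb, hb'⟩
    refine ⟨G.mul_mem ha hb, ?_⟩
    have : (a * b).2 ℓ = a.2 (b.2 ℓ) := rfl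
    rw [this, hb', ha']
  inv_mem' := by
    rintro a ⟨ha, ha'⟩
    refine ⟨G.inv_mem ha, ?_⟩
    have h : a⁻¹.2 (a.2 ℓ) = ℓ := by simp
    rw [ha'] at h
    exact h

/-- Isomorphism of incidence structures: a pair of bijections between the point sets and
the line sets preserving incidence in both directions. -/
def IsoTo {P L P' L' : Type*} (I : P → L → Prop) (I' : P' → L' → Prop) : Prop :=
  ∃ (e : P ≃ P') (f : L ≃ L'), ∀ p ℓ, I' (e p) (f ℓ) ↔ I p ℓ

end GQDefs

section ClassicalGQs

/-- The standard nondegenerate alternating bilinear form on `F^4`. -/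
def sympForm {F : Type*} [Field F] (x y : Fin 4 → F) : F :=
  x 0 * y 1 - x 1 * y 0 + x 2 * y 3 - x 3 * y 2

/-- Points of `W(3,q)`: the `1`-dimensional subspaces of `F_q^4`. -/
def W3Point (F : Type*) [Field F] : Type _ :=
  {W : Submodule F (Fin 4 → F) // Module.finrank F W = 1}

/-- Lines of `W(3,q)`: the `2`-dimensional totally isotropic subspaces of `F_q^4` with
respect to a nondegenerate alternating form. -/
def W3Line (F : Type*) [Field F] : Type _ :=
  {U : Submodule F (Fin 4 → F) //
    Module.finrank F U = 2 ∧ ∀ x ∈ U, ∀ y ∈ U, sympForm x y = 0}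

/-- Incidence in `W(3,q)` is given by inclusion. -/
def W3Incid (F : Type*) [Field F] : W3Point F → W3Line F → Prop :=
  fun W U => W.1 ≤ U.1

/-- The standard nondegenerate Hermitian sesquilinear form on `F_{q²}^4`, relative to the
field automorphism `x ↦ x^q`. -/
def hermForm3 {F : Type*} [Field F] (q : ℕ) (x y : Fin 4 → F) : F :=
  x 0 * y 1 ^ q + x 1 * y 0 ^ q + x 2 * y 3 ^ q + x 3 * y 2 ^ q

/-- The standard nondegenerate Hermitian sesquilinear form on `F_{q²}^5`, relative to the
field automorphism `x ↦ x^q`. -/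
def hermForm4 {F : Type*} [Field F] (q : ℕ) (x y : Fin 5 → F) : F :=
  x 0 * y 1 ^ q + x 1 * y 0 ^ q + x 2 * y 3 ^ q + x 3 * y 2 ^ q + x 4 * y 4 ^ q

/-- Points of `H(3,q²)`: the `1`-dimensional isotropic subspaces of `F_{q²}^4`. -/
def H3Point (F : Type*) [Field F] (q : ℕ) : Type _ :=
  {W : Submodule F (Fin 4 → F) //
    Module.finrank F W = 1 ∧ ∀ x ∈ W, hermForm3 q x x = 0}

/-- Lines of `H(3,q²)`: the `2`-dimensional totally isotropic subspaces of `F_{q²}^4`. -/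
def H3Line (F : Type*) [Field F] (q : ℕ) : Type _ :=
  {U : Submodule F (Fin 4 → F) //
    Module.finrank F U = 2 ∧ ∀ x ∈ U, ∀ y ∈ U, hermForm3 q x y = 0}

/-- Incidence in `H(3,q²)` is given by inclusion. -/
def H3Incid (F : Type*) [Field F] (q : ℕ) : H3Point F q → H3Line F q → Prop :=
  fun W U => W.1 ≤ U.1

/-- Points of `H(4,q²)`: the `1`-dimensional isotropic subspaces of `F_{q²}^5`. -/
def H4Point (F : Type*) [Field F] (q : ℕ) : Type _ :=
  {W : Submodule F (Fin 5 → F) //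
    Module.finrank F W = 1 ∧ ∀ x ∈ W, hermForm4 q x x = 0}

/-- Lines of `H(4,q²)`: the `2`-dimensional totally isotropic subspaces of `F_{q²}^5`. -/
def H4Line (F : Type*) [Field F] (q : ℕ) : Type _ :=
  {U : Submodule F (Fin 5 → F) //
    Module.finrank F U = 2 ∧ ∀ x ∈ U, ∀ y ∈ U, hermForm4 q x y = 0}

/-- Incidence in `H(4,q²)` is given by inclusion. -/
def H4Incid (F : Type*) [Field F] (q : ℕ) : H4Point F q → H4Line F q → Prop :=
  fun W U => W.1 ≤ U.1

end ClassicalGQs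

section GQ

variable {P L : Type*} {I : P → L → Prop} {s t : ℕ}

theorem exists_ne_ne_of_two_lt_card {α : Type*} [Finite α] {p : α → Prop}
    (h : 2 < Nat.card {a // p a}) (a b : α) : ∃ c, p c ∧ c ≠ a ∧ c ≠ b := by
  have h1 : ({a, b} : Set α).ncard < {c | p c}.ncard :=
    lt_of_le_of_lt ((Set.ncard_insert_le a {b}).trans (by simp)) h
  obtain ⟨c, hc, hc'⟩ := Set.exists_mem_notMem_of_ncard_lt_ncard h1 (Set.toFinite _)
  simp only [Set.mem_insert_iff, Set.mem_singleton_iff, not_or] at hc'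
  exact ⟨c, hc, hc'⟩

theorem card_sigma_const {α : Type*} [Finite α] {β : α → Type*} [∀ a, Finite (β a)] {n : ℕ}
    (h : ∀ a, Nat.card (β a) = n) : Nat.card (Sigma β) = Nat.card α * n := by
  have := Fintype.ofFinite α
  simp [Nat.card_sigma, h, Nat.card_eq_fintype_card]

theorem card_subtype_and_ne {α : Type*} [Finite α] {p : α → Prop} {n : ℕ} {a : α} (ha : p a)
    (h : Nat.card {b // p b} = n + 1) : Nat.card {b // p b ∧ b ≠ a} = n := by
  have h1 : ({b | p b} \ {a}).ncard = n := by
    rw [Set.ncard_sdiff_singleton_of_mem (show a ∈ {b | p b} from ha)]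
    exact Nat.sub_eq_of_eq_add h
  exact h1

theorem card_modEq_card_fixed {α : Type*} [Finite α] {r : ℕ} (hr : r.Prime) {σ : Perm α}
    (hσ : σ ^ r = 1) : Nat.card α ≡ Nat.card {a // σ a = a} [MOD r] := by
  classical
  have := Fact.mk hr
  have := Fintype.ofFinite α
  let f : Function.End α := ⇑σ
  have hpow : ∀ n : ℕ, f ^ n = ⇑(σ ^ n) := by
    intro n
    induction n with
    | zero => rfl
    | succ n ih =>
      rw [pow_succ, pow_succ, ih]
      rfl
  have hf : f ^ r ^ 1 = 1 := by
    rw [pow_one, hpow, hσ]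
    rfl
  rw [Nat.card_eq_fintype_card, Nat.card_eq_fintype_card]
  exact Equiv.Perm.card_fixedPoints_modEq hf

theorem Coll.symm {x y : P} (h : Coll I x y) : Coll I y x := by
  obtain ⟨ℓ, hx, hy⟩ := h
  exact ⟨ℓ, hy, hx⟩

theorem Coll.map {g : Perm P × Perm L} (hg : g ∈ autGroup I) {x y : P} (h : Coll I x y) :
    Coll I (g.1 x) (g.1 y) := by
  obtain ⟨ℓ, hx, hy⟩ := h
  exact ⟨g.2 ℓ, (hg x ℓ).2 hx, (hg y ℓ).2 hy⟩

namespace IsGQ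

theorem exists_line_ne [Finite L] (hGQ : IsGQ I s t) (ht : 2 ≤ t) (p : P) (ℓ : L) :
    ∃ M, I p M ∧ M ≠ ℓ := by
  obtain ⟨M, h, h', -⟩ := exists_ne_ne_of_two_lt_card
    (by rw [hGQ.line_count p]; omega : 2 < Nat.card {ℓ : L // I p ℓ}) ℓ ℓ
  exact ⟨M, h, h'⟩

theorem exists_line (hGQ : IsGQ I s t) (p : P) : ∃ M, I p M := by
  by_contra! h
  have : IsEmpty {ℓ : L // I p ℓ} := ⟨fun x => h x.1 x.2⟩
  have := hGQ.line_count p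
  simp at this

theorem coll_self (hGQ : IsGQ I s t) (p : P) : Coll I p p := by
  obtain ⟨M, hM⟩ := hGQ.exists_line p
  exact ⟨M, hM, hM⟩

theorem exists_point_ne_ne [Finite P] (hGQ : IsGQ I s t) (hs : 2 ≤ s) (ℓ : L) (a b : P) :
    ∃ c, I c ℓ ∧ c ≠ a ∧ c ≠ b :=
  exists_ne_ne_of_two_lt_card
    (by rw [hGQ.point_count ℓ]; omega : 2 < Nat.card {p : P // I p ℓ}) a b

/-- A generalized quadrangle contains no triangles. -/
theorem incident_of_coll_coll (hGQ : IsGQ I s t) {a b c : P} {ℓ : L} (ha : I a ℓ) (hb : I b ℓ)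
    (hab : a ≠ b) (hca : Coll I c a) (hcb : Coll I c b) : I c ℓ := by
  by_contra h
  obtain ⟨M, hM, hM'⟩ := hca
  obtain ⟨N, hN, hN'⟩ := hcb
  have := (hGQ.quad h).unique (y₁ := (a, M)) (y₂ := (b, N)) ⟨hM, hM', ha⟩ ⟨hN, hN', hb⟩
  exact hab (congrArg Prod.fst this)

theorem exists_coll (hGQ : IsGQ I s t) (c : P) (ℓ : L) : ∃ q, I q ℓ ∧ Coll I c q := by
  by_cases h : I c ℓ
  · exact ⟨c, h, ℓ, h, h⟩
  · obtain ⟨⟨q, M⟩, ⟨h1, h2, h3⟩, -⟩ := hGQ.quad h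
    exact ⟨q, h3, M, h1, h2⟩

/-- A symmetry about `x` fixing a point not collinear with `x` fixes all its neighbours. -/
theorem fixed_of_coll_fixed [Finite L] (hGQ : IsGQ I s t) (ht : 2 ≤ t) {x y z : P}
    {g : Perm P × Perm L} (hg : g ∈ symmGroup I x) (hxy : ¬ Coll I x y) (hy : g.1 y = y)
    (hyz : Coll I y z) : g.1 z = z := by
  obtain ⟨K, hyK, hzK⟩ := hyz
  have hxK : ¬ I x K := fun h => hxy ⟨K, h, hyK⟩
  obtain ⟨u, huK, hxu⟩ := hGQ.exists_coll x K
  have huy : u ≠ y := by rintro rfl; exact hxy hxu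
  have hu : g.1 u = u := hg.2 u hxu
  have hK : g.2 K = K := hGQ.unique_line huy
    (by simpa [hu] using (hg.1 u K).2 huK) (by simpa [hy] using (hg.1 y K).2 hyK) huK hyK
  by_contra hz
  obtain ⟨M₀, hxM₀, huM₀⟩ := id hxu
  obtain ⟨M, hxM, hM⟩ := hGQ.exists_line_ne ht x M₀
  obtain ⟨q, hqM, hzq⟩ := hGQ.exists_coll z M
  have hxq : Coll I x q := ⟨M, hxM, hqM⟩
  have hq : g.1 q = q := hg.2 q hxq
  have hgzK : I (g.1 z) K := by simpa [hK] using (hg.1 z K).2 hzK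
  have hgzq : Coll I (g.1 z) q := by simpa [hq] using hzq.map hg.1
  have hqK : I q K := hGQ.incident_of_coll_coll hgzK hzK hz hgzq.symm hzq.symm
  have hqu : q = u := by
    by_contra h
    exact hxK (hGQ.incident_of_coll_coll hqK huK h hxq hxu)
  subst hqu
  have hxq' : x ≠ q := by rintro rfl; exact hxK huK
  exact hM (hGQ.unique_line hxq' hxM hqM hxM₀ huM₀)

/-- A nontrivial symmetry about `x` fixes only the points collinear with `x`. -/
theorem eq_one_of_fixed [Finite P] [Finite L] (hGQ : IsGQ I s t) (hs : 2 ≤ s) (ht : 2 ≤ t)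
    {x y : P} {g : Perm P × Perm L} (hg : g ∈ symmGroup I x) (hxy : ¬ Coll I x y)
    (hy : g.1 y = y) : g = 1 := by
  have key : ∀ z, g.1 z = z := by
    intro z
    by_contra hz
    have hxz : ¬ Coll I x z := fun h => hz (hg.2 z h)
    have hC : ∀ v, g.1 v ≠ v → ∀ w, Coll I y w → Coll I w v → Coll I x w := by
      intro v hv w hyw hwv
      by_contra hxw
      exact hv (hGQ.fixed_of_coll_fixed ht hg hxw (hGQ.fixed_of_coll_fixed ht hg hxy hy hyw) hwv)
    obtain ⟨K, hzK⟩ := hGQ.exists_line z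
    have hxK : ¬ I x K := fun h => hxz ⟨K, h, hzK⟩
    obtain ⟨u, huK, hxu⟩ := hGQ.exists_coll x K
    obtain ⟨v, hvK, hvz, hvu⟩ := hGQ.exists_point_ne_ne hs K z u
    have hxv : ¬ Coll I x v := fun h =>
      hxK (hGQ.incident_of_coll_coll hvK huK hvu h hxu)
    have hv : g.1 v ≠ v := fun h => hz (hGQ.fixed_of_coll_fixed ht hg hxv h ⟨K, hvK, hzK⟩)
    obtain ⟨K₂, hvK₂, hK₂⟩ := hGQ.exists_line_ne ht v K
    obtain ⟨w, hwK₂, hyw⟩ := hGQ.exists_coll y K₂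
    have hxw := hC v hv w hyw ⟨K₂, hwK₂, hvK₂⟩
    obtain ⟨N, hyN, hwN⟩ := id hyw
    obtain ⟨q, hqN, hzq⟩ := hGQ.exists_coll z N
    have hxq := hC z hz q ⟨N, hyN, hqN⟩ hzq.symm
    have hqw : q = w := by
      by_contra h
      exact hxy ⟨N, hGQ.incident_of_coll_coll hqN hwN h hxq hxw, hyN⟩
    subst hqw
    have hqK : I q K :=
      hGQ.incident_of_coll_coll hvK hzK hvz ⟨K₂, hwK₂, hvK₂⟩ hzq.symm
    have hvq : v ≠ q := by rintro rfl; exact hxv hxw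
    exact hK₂ (hGQ.unique_line hvq hvK₂ hwK₂ hvK hqK)
  refine Prod.ext (Equiv.ext key) (Equiv.ext fun ℓ => ?_)
  obtain ⟨a, ha, -⟩ := hGQ.exists_point_ne_ne hs ℓ x x
  obtain ⟨b, hb, hba, -⟩ := hGQ.exists_point_ne_ne hs ℓ a a
  exact hGQ.unique_line hba (by simpa [key] using (hg.1 b ℓ).2 hb)
    (by simpa [key] using (hg.1 a ℓ).2 ha) hb ha

theorem eq_one_of_mem_symmGroup [Finite P] [Finite L] (hGQ : IsGQ I s t) (hs : 2 ≤ s)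
    (ht : 2 ≤ t) {x y : P} (hne : x ≠ y) {g : Perm P × Perm L} (hx : g ∈ symmGroup I x)
    (hy : g ∈ symmGroup I y) : g = 1 := by
  by_cases hxy : Coll I x y
  · obtain ⟨ℓ, hxℓ, hyℓ⟩ := id hxy
    obtain ⟨M, hyM, hM⟩ := hGQ.exists_line_ne ht y ℓ
    obtain ⟨w, hwM, hwy, -⟩ := hGQ.exists_point_ne_ne hs M y y
    refine hGQ.eq_one_of_fixed hs ht hx (fun h => hM ?_) (hy.2 w ⟨M, hyM, hwM⟩)
    have hxM := hGQ.incident_of_coll_coll hwM hyM hwy h hxy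
    exact hGQ.unique_line hne hxM hyM hxℓ hyℓ
  · exact hGQ.eq_one_of_fixed hs ht hx hxy (hy.2 y (hGQ.coll_self y))

/-- Two distinct points collinear with every point of `{y,z}^⊥`, where `y` and `z` are not
collinear, are not collinear. -/
theorem not_coll_of_perp [Finite L] (hGQ : IsGQ I s t) (ht : 2 ≤ t) {y z a w : P}
    (hyz : ¬ Coll I y z) (ha : ∀ u, Coll I u y → Coll I u z → Coll I u a)
    (hw : ∀ u, Coll I u y → Coll I u z → Coll I u w) (haw : a ≠ w) : ¬ Coll I a w := by
  rintro ⟨N, haN, hwN⟩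
  obtain ⟨M₁, hyM₁⟩ := hGQ.exists_line y
  obtain ⟨M₂, hyM₂, hM⟩ := hGQ.exists_line_ne ht y M₁
  obtain ⟨u₁, hu₁, hzu₁⟩ := hGQ.exists_coll z M₁
  obtain ⟨u₂, hu₂, hzu₂⟩ := hGQ.exists_coll z M₂
  have hyu₁ : Coll I y u₁ := ⟨M₁, hyM₁, hu₁⟩
  have hyu₂ : Coll I y u₂ := ⟨M₂, hyM₂, hu₂⟩
  have hne : u₁ ≠ u₂ := by
    rintro rfl
    have : y ≠ u₁ := by rintro rfl; exact hyz hzu₁.symm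
    exact hM (hGQ.unique_line this hyM₂ hu₂ hyM₁ hu₁)
  have h₁ := hGQ.incident_of_coll_coll haN hwN haw (ha _ hyu₁.symm hzu₁.symm)
    (hw _ hyu₁.symm hzu₁.symm)
  have h₂ := hGQ.incident_of_coll_coll haN hwN haw (ha _ hyu₂.symm hzu₂.symm)
    (hw _ hyu₂.symm hzu₂.symm)
  exact hyz ⟨N, hGQ.incident_of_coll_coll h₁ h₂ hne hyu₁ hyu₂,
    hGQ.incident_of_coll_coll h₁ h₂ hne hzu₁ hzu₂⟩

/-- Two noncollinear centers of symmetries of prime order `r` are in the same orbit of the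
group generated by these symmetries. -/
theorem exists_mem_closure_apply_eq [Finite P] [Finite L] (hGQ : IsGQ I s t) (hs : 2 ≤ s)
    (ht : 2 ≤ t) {r : ℕ} (hr : r.Prime) {y z : P} (hyz : ¬ Coll I y z) {g h : Perm P × Perm L}
    (hg : g ∈ symmGroup I y) (hg1 : g ≠ 1) (hgr : g ^ r = 1)
    (hh : h ∈ symmGroup I z) (hh1 : h ≠ 1) (hhr : h ^ r = 1) :
    ∃ k ∈ Subgroup.closure {g, h}, k.1 y = z := by
  set K := Subgroup.closure {g, h} with hK
  have hgK : g ∈ K := Subgroup.subset_closure (by simp)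
  have hhK : h ∈ K := Subgroup.subset_closure (by simp)
  by_contra! hz
  let O : Set P := {w | ∃ k ∈ K, k.1 y = w}
  have hO : ∀ k ∈ K, ∀ w, k.1 w ∈ O ↔ w ∈ O := by
    intro k hk w
    constructor
    · rintro ⟨l, hl, hlw⟩
      exact ⟨k⁻¹ * l, K.mul_mem (K.inv_mem hk) hl, by simp [hlw]⟩
    · rintro ⟨l, hl, rfl⟩
      exact ⟨k * l, K.mul_mem hk hl, rfl⟩
  have hyO : y ∈ O := ⟨1, K.one_mem, rfl⟩
  have hzO : z ∉ O := fun ⟨k, hk, hkz⟩ => hz k hk hkz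
  have hperp : ∀ w ∈ O, ∀ u, Coll I u y → Coll I u z → Coll I u w := by
    rintro w ⟨k, hk, rfl⟩ u huy huz
    have hle : K ≤ stabPt (autGroup I) u := by
      rw [hK, Subgroup.closure_le]
      rintro x (rfl | rfl)
      · exact ⟨hg.1, hg.2 u huy.symm⟩
      · exact ⟨hh.1, hh.2 u huz.symm⟩
    have := huy.map (hle hk).1
    rwa [(hle hk).2] at this
  have hcong : ∀ k (hk : k ∈ K), k ^ r = 1 →
      Nat.card O ≡ Nat.card {w : O // k.1 w = w} [MOD r] := by
    intro k hk hkr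
    have hpow : k.1 ^ r = 1 := congrArg Prod.fst hkr
    have hmod := card_modEq_card_fixed hr (σ := k.1.subtypePerm (hO k hk)) <| by
      rw [Equiv.Perm.subtypePerm_pow]
      ext w
      simp [hpow]
    simpa [Subtype.ext_iff] using hmod
  have hone : Nat.card {w : O // g.1 w = w} = 1 := by
    rw [Nat.card_eq_one_iff_unique]
    refine ⟨⟨fun a b => ?_⟩, ⟨⟨⟨y, hyO⟩, hg.2 y (hGQ.coll_self y)⟩⟩⟩
    have : ∀ c : {w : O // g.1 w = w}, c.1.1 = y := by
      rintro ⟨⟨c, hc⟩, hgc⟩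
      by_contra hne
      exact hg1 (hGQ.eq_one_of_fixed hs ht hg
        (hGQ.not_coll_of_perp ht hyz (fun u h _ => h) (hperp c hc) (Ne.symm hne)) hgc)
    exact Subtype.ext (Subtype.ext ((this a).trans (this b).symm))
  have hzero : Nat.card {w : O // h.1 w = w} = 0 := by
    have : IsEmpty {w : O // h.1 w = w} := by
      refine ⟨?_⟩
      rintro ⟨⟨c, hc⟩, hhc⟩
      have hne : z ≠ c := by rintro rfl; exact hzO hc
      exact hh1 (hGQ.eq_one_of_fixed hs ht hh
        (hGQ.not_coll_of_perp ht hyz (fun u _ h => h) (hperp c hc) hne) hhc)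
    simp
  have h1 := hcong g hgK hgr
  have h0 := hcong h hhK hhr
  rw [hone] at h1
  rw [hzero] at h0
  have h10 := (Nat.modEq_zero_iff_dvd).1 (h1.symm.trans h0)
  exact hr.one_lt.ne' (Nat.dvd_one.1 h10)

theorem card_point_le [Finite P] [Finite L] (hGQ : IsGQ I s t) (hs : 2 ≤ s) (ℓ : L) :
    Nat.card P ≤ (s + 1) * ((t + 1) * s) := by
  let X := Σ q : {q : P // I q ℓ}, Σ M : {M : L // I q.1 M}, {z : P // I z M.1 ∧ z ≠ q.1}
  have hX : Nat.card X = (s + 1) * ((t + 1) * s) := by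
    rw [← hGQ.point_count ℓ]
    refine card_sigma_const fun q => ?_
    rw [← hGQ.line_count q.1]
    exact card_sigma_const fun M => card_subtype_and_ne M.2 (hGQ.point_count M.1)
  rw [← hX]
  refine Nat.card_le_card_of_surjective (fun x : X => x.2.2.1) fun z => ?_
  obtain ⟨q, hqℓ, hqz, M, hzM, hqM⟩ : ∃ q, I q ℓ ∧ z ≠ q ∧ Coll I z q := by
    by_cases hz : I z ℓ
    · obtain ⟨q, hq, hqz, -⟩ := hGQ.exists_point_ne_ne hs ℓ z z
      exact ⟨q, hq, hqz.symm, ℓ, hz, hq⟩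
    · obtain ⟨q, hq, hzq⟩ := hGQ.exists_coll z ℓ
      exact ⟨q, hq, by rintro rfl; exact hz hq, hzq⟩
  exact ⟨⟨⟨q, hqℓ⟩, ⟨M, hqM⟩, ⟨z, hzM, hqz⟩⟩, rfl⟩

theorem le_card_coll_ne [Finite P] [Finite L] (hGQ : IsGQ I s t) (p : P) :
    (t + 1) * s ≤ Nat.card {y // Coll I p y ∧ y ≠ p} := by
  let X := Σ M : {M : L // I p M}, {z : P // I z M.1 ∧ z ≠ p}
  have hX : Nat.card X = (t + 1) * s := by
    rw [← hGQ.line_count p]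
    exact card_sigma_const fun M => card_subtype_and_ne M.2 (hGQ.point_count M.1)
  rw [← hX]
  refine Nat.card_le_card_of_injective
    (fun x : X => (⟨x.2.1, ⟨x.1.1, x.1.2, x.2.2.1⟩, x.2.2.2⟩ : {y // Coll I p y ∧ y ≠ p})) ?_
  rintro ⟨⟨M, hM⟩, ⟨z, hz, hzp⟩⟩ ⟨⟨N, hN⟩, ⟨w, hw, hwp⟩⟩ h
  obtain rfl : z = w := congrArg Subtype.val h
  obtain rfl : M = N := hGQ.unique_line hzp hz hM hw hN
  rfl

end IsGQ

theorem card_eq_card_orbit_mul_card_stabPt (G : Subgroup (Perm P × Perm L)) (u : P) :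
    Nat.card G = Nat.card {w // ∃ g ∈ G, g.1 u = w} * Nat.card (stabPt G u) := by
  let _ : MulAction G P := MulAction.compHom P ((MonoidHom.fst (Perm P) (Perm L)).comp G.subtype)
  have hsmul : ∀ (g : G) (w : P), g • w = g.1.1 w := fun _ _ => rfl
  have h1 : Nat.card (MulAction.orbit G u) = Nat.card {w // ∃ g ∈ G, g.1 u = w} :=
    Nat.card_congr (Equiv.subtypeEquivRight fun w => by
      rw [MulAction.mem_orbit_iff, Subtype.exists]
      simp only [hsmul, exists_prop])
  have h2 : Nat.card (MulAction.stabilizer G u) = Nat.card (stabPt G u) :=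
    Nat.card_congr
      { toFun := fun g => ⟨g.1.1, g.1.2, g.2⟩
        invFun := fun g => ⟨⟨g.1, g.2.1⟩, g.2.2⟩
        left_inv := fun _ => rfl
        right_inv := fun _ => rfl }
  rw [← h1, ← h2, Nat.card_coe_set_eq, ← MulAction.index_stabilizer, mul_comm,
    Subgroup.card_mul_index]

section SymmetryFamily

variable {E : P → Subgroup (Perm P × Perm L)}

/-- Symmetries in a conjugation-invariant family with collinear centers commute. -/
theorem IsGQ.commute_of_coll [Finite P] [Finite L] (hGQ : IsGQ I s t) (hs : 2 ≤ s) (ht : 2 ≤ t)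
    (hEsym : ∀ x, E x ≤ symmGroup I x)
    (habel : ∀ x, ∀ g ∈ E x, ∀ h ∈ E x, g * h = h * g)
    (hconj : ∀ g ∈ (⨆ p, E p), ∀ p, E (g.1 p) = (E p).map (MulAut.conj g).toMonoidHom)
    {x y : P} (hxy : Coll I x y) {g h : Perm P × Perm L} (hg : g ∈ E x) (hh : h ∈ E y) :
    g * h = h * g := by
  by_cases hne : x = y
  · subst hne
    exact habel x g hg h hh
  have hconj' : ∀ {x y : P}, Coll I x y → ∀ {g h : Perm P × Perm L}, g ∈ E x → h ∈ E y →
      g * h * g⁻¹ ∈ E y := by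
    intro x y hxy g h hg hh
    have := hconj g (Subgroup.mem_iSup_of_mem x hg) y
    rw [(hEsym x hg).2 y hxy] at this
    rw [this]
    exact ⟨h, hh, rfl⟩
  have hy : g * h * g⁻¹ * h⁻¹ ∈ E y := (E y).mul_mem (hconj' hxy hg hh) ((E y).inv_mem hh)
  have hx : g * h * g⁻¹ * h⁻¹ ∈ E x := by
    have := (E x).mul_mem hg (hconj' hxy.symm hh ((E x).inv_mem hg))
    simpa only [mul_assoc] using this
  have := hGQ.eq_one_of_mem_symmGroup hs ht hne (hEsym x hx) (hEsym y hy)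
  rwa [mul_inv_eq_one, mul_inv_eq_iff_eq_mul] at this

/-- The symmetries centered at the points of a line generate a large elementary abelian group. -/
theorem IsGQ.exists_elementary_abelian [Finite P] [Finite L] (hGQ : IsGQ I s t) (hs : 2 ≤ s)
    (ht : 2 ≤ t) {r n : ℕ} (hEsym : ∀ x, E x ≤ symmGroup I x)
    (hcard : ∀ x, Nat.card (E x) = n + 1)
    (helem : ∀ x, ∀ g ∈ E x, g ^ r = 1)
    (habel : ∀ x, ∀ g ∈ E x, ∀ h ∈ E x, g * h = h * g)
    (hconj : ∀ g ∈ (⨆ p, E p), ∀ p, E (g.1 p) = (E p).map (MulAut.conj g).toMonoidHom) (ℓ : L) :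
    ∃ H : Subgroup (Perm P × Perm L), H ≤ ⨆ x, E x ∧ (∀ g ∈ H, ∀ x, I x ℓ → g.1 x = x) ∧
      (∀ g ∈ H, g ^ r = 1) ∧ (∀ g ∈ H, ∀ h ∈ H, g * h = h * g) ∧
      n * (s + 1) + 1 ≤ Nat.card H ∧ ∀ x, I x ℓ → E x ≤ H := by
  let S : Set (Perm P × Perm L) := {g | ∃ x, I x ℓ ∧ g ∈ E x}
  have hmem : ∀ x, I x ℓ → E x ≤ Subgroup.closure S :=
    fun x hx g hg => Subgroup.subset_closure ⟨x, hx, hg⟩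
  have hS : Subgroup.closure S ≤ Subgroup.centralizer S := by
    rw [Subgroup.closure_le]
    rintro g ⟨x, hx, hg⟩
    rw [SetLike.mem_coe, Subgroup.mem_centralizer_iff]
    rintro h ⟨y, hy, hh⟩
    exact hGQ.commute_of_coll hs ht hEsym habel hconj ⟨ℓ, hy, hx⟩ hh hg
  have hcomm : ∀ g ∈ Subgroup.closure S, ∀ h ∈ Subgroup.closure S, g * h = h * g := by
    intro g hg h hh
    have : Subgroup.closure S ≤ Subgroup.centralizer {h} := by
      rw [Subgroup.closure_le]
      intro k hk
      rw [SetLike.mem_coe, Subgroup.mem_centralizer_iff]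
      rintro _ rfl
      exact (Subgroup.mem_centralizer_iff.1 (hS hh) k hk).symm
    exact (Subgroup.mem_centralizer_iff.1 (this hg) h rfl).symm
  refine ⟨Subgroup.closure S, ?_, ?_, ?_, hcomm, ?_, hmem⟩
  · rw [Subgroup.closure_le]
    rintro g ⟨x, hx, hg⟩
    exact Subgroup.mem_iSup_of_mem x hg
  · intro g hg x hx
    have : Subgroup.closure S ≤ stabPt ⊤ x := by
      rw [Subgroup.closure_le]
      rintro h ⟨y, hy, hh⟩
      exact ⟨Subgroup.mem_top _, (hEsym y hh).2 x ⟨ℓ, hy, hx⟩⟩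
    exact (this hg).2
  · intro g hg
    induction hg using Subgroup.closure_induction with
    | mem g hg =>
      obtain ⟨x, -, hx⟩ := hg
      exact helem x g hx
    | one => exact one_pow r
    | mul a b ha hb iha ihb =>
      rw [(show Commute a b from hcomm a ha b hb).mul_pow, iha, ihb, one_mul]
    | inv a ha iha => rw [inv_pow, iha, inv_one]
  · let X := Σ x : {x : P // I x ℓ}, {g // g ∈ E x ∧ g ≠ 1}
    have hX : Nat.card (Option X) = n * (s + 1) + 1 := by
      rw [Finite.card_option, ← hGQ.point_count ℓ, mul_comm n]
      congr 1
      exact card_sigma_const fun x => card_subtype_and_ne (E x).one_mem (hcard x)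
    rw [← hX]
    let f : Option X → Subgroup.closure S := fun o =>
      o.elim 1 fun x => ⟨x.2.1, hmem x.1 x.1.2 x.2.2.1⟩
    refine Nat.card_le_card_of_injective f ?_
    rintro (_ | ⟨⟨x, hx⟩, g, hg, hg1⟩) (_ | ⟨⟨y, hy⟩, h, hh, hh1⟩) hf
    · rfl
    · exact (hh1 (congrArg Subtype.val hf).symm).elim
    · exact (hg1 (congrArg Subtype.val hf)).elim
    · obtain rfl : g = h := congrArg Subtype.val hf
      obtain rfl : x = y := by
        by_contra hne
        exact hg1 (hGQ.eq_one_of_mem_symmGroup hs ht hne (hEsym x hg) (hEsym y hh))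
      rfl

/-- The stabilizer of `p` is transitive on the points collinear with and distinct from `p`. -/
theorem IsGQ.exists_mem_stabPt_apply_eq [Finite P] [Finite L] (hGQ : IsGQ I s t) (hs : 2 ≤ s)
    (ht : 2 ≤ t) {r : ℕ} (hr : r.Prime) (hEsym : ∀ x, E x ≤ symmGroup I x)
    (hE : ∀ x, E x ≠ ⊥) (helem : ∀ x, ∀ g ∈ E x, g ^ r = 1) {p a b : P}
    (hpa : Coll I p a) (ha : a ≠ p) (hpb : Coll I p b) (hb : b ≠ p) :
    ∃ k ∈ stabPt (⨆ x, E x) p, k.1 a = b := by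
  have key : ∀ {a b : P}, Coll I p a → Coll I p b → ¬ Coll I a b →
      ∃ k ∈ stabPt (⨆ x, E x) p, k.1 a = b := by
    intro a b hpa hpb hab
    obtain ⟨g, hg, hg1⟩ := (E a).bot_or_exists_ne_one.resolve_left (hE a)
    obtain ⟨h, hh, hh1⟩ := (E b).bot_or_exists_ne_one.resolve_left (hE b)
    obtain ⟨k, hk, hkab⟩ := hGQ.exists_mem_closure_apply_eq hs ht hr hab (hEsym a hg) hg1
      (helem a g hg) (hEsym b hh) hh1 (helem b h hh)
    refine ⟨k, ?_, hkab⟩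
    refine (Subgroup.closure_le _).2 ?_ hk
    rintro x (rfl | rfl)
    · exact ⟨Subgroup.mem_iSup_of_mem a hg, (hEsym a hg).2 p hpa.symm⟩
    · exact ⟨Subgroup.mem_iSup_of_mem b hh, (hEsym b hh).2 p hpb.symm⟩
  by_cases hab : Coll I a b
  · obtain ⟨ℓ, hpℓ, haℓ⟩ := id hpa
    have hbℓ : I b ℓ := hGQ.incident_of_coll_coll haℓ hpℓ ha hab.symm hpb.symm
    obtain ⟨M, hpM, hM⟩ := hGQ.exists_line_ne ht p ℓ
    obtain ⟨c, hcM, hcp, -⟩ := hGQ.exists_point_ne_ne hs M p p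
    have hpc : Coll I p c := ⟨M, hpM, hcM⟩
    have hc : ∀ d, I d ℓ → d ≠ p → ¬ Coll I c d := fun d hd hdp hcd =>
      hM (hGQ.unique_line hcp hcM hpM
        (hGQ.incident_of_coll_coll hd hpℓ hdp hcd hpc.symm) hpℓ)
    obtain ⟨k, hk, hkac⟩ := key hpa hpc fun h => hc a haℓ ha h.symm
    obtain ⟨l, hl, hlcb⟩ := key hpc hpb (hc b hbℓ hb)
    exact ⟨l * k, Subgroup.mul_mem _ hl hk, by simp [hkac, hlcb]⟩
  · exact key hpa hpb hab

end SymmetryFamily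

end GQ

/-- Let `E(x)` be elementary abelian `r`-groups of symmetries of order `r^m`, closed under
conjugation by `G = ⟨E(x) : x⟩`. Then for each point `p`, the stabilizer `G_p` contains an
elementary abelian `r`-subgroup `H` of order at least `(r^m − 1)(s+1) + 1` centralizing
`E(p)`, and `|G| < |G_p|²`. -/
theorem stab_large_elementary_abelian {P L : Type} [Finite P] [Finite L]
    (I : P → L → Prop) (s t : ℕ) (hGQ : IsGQ I s t) (hs : 2 ≤ s) (ht : 2 ≤ t)
    (r m : ℕ) (hr : r.Prime) (hm : 1 ≤ m)
    (E : P → Subgroup (Equiv.Perm P × Equiv.Perm L))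
    (hEsym : ∀ x : P, E x ≤ symmGroup I x)
    (hcard : ∀ x : P, Nat.card (E x) = r ^ m)
    (helem : ∀ x : P, ∀ g ∈ E x, g ^ r = 1)
    (habel : ∀ x : P, ∀ g ∈ E x, ∀ h ∈ E x, g * h = h * g)
    (hconj : ∀ g ∈ (⨆ p : P, E p : Subgroup (Equiv.Perm P × Equiv.Perm L)), ∀ p : P,
      E (g.1 p) = (E p).map (MulAut.conj g).toMonoidHom) :
    ∀ p : P,
      (∃ H : Subgroup (Equiv.Perm P × Equiv.Perm L),
        H ≤ stabPt (⨆ x : P, E x) p ∧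
        (∀ g ∈ H, g ^ r = 1) ∧
        (∀ g ∈ H, ∀ h ∈ H, g * h = h * g) ∧
        (r ^ m - 1) * (s + 1) + 1 ≤ Nat.card H ∧
        (∀ h ∈ H, ∀ e ∈ E p, h * e = e * h)) ∧
      Nat.card (⨆ x : P, E x : Subgroup (Equiv.Perm P × Equiv.Perm L)) <
        (Nat.card (stabPt (⨆ x : P, E x) p)) ^ 2 := by
  have hpow : 2 ≤ r ^ m := hr.two_le.trans (Nat.le_self_pow (by omega) r)
  have hE : ∀ x, E x ≠ ⊥ := by
    intro x hx
    have := hcard x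
    rw [hx, Subgroup.card_bot] at this
    omega
  have hH := hGQ.exists_elementary_abelian hs ht (n := r ^ m - 1) hEsym
    (fun x => by rw [hcard x]; omega) helem habel hconj
  intro p
  obtain ⟨ℓ, hpℓ⟩ := hGQ.exists_line p
  obtain ⟨H, hHG, hHfix, hHelem, hHcomm, hHcard, hHE⟩ := hH ℓ
  refine ⟨⟨H, fun g hg => ⟨hHG hg, hHfix g hg p hpℓ⟩, hHelem, hHcomm, hHcard,
    fun h hh e he => hHcomm h hh e (hHE p hpℓ he)⟩, ?_⟩
  set G : Subgroup (Perm P × Perm L) := ⨆ x, E x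
  obtain ⟨y, hyℓ, hyp, -⟩ := hGQ.exists_point_ne_ne hs ℓ p p
  have hHle : Nat.card H ≤ Nat.card (stabPt (stabPt G p) y) :=
    Subgroup.card_le_of_le
      fun g hg => ⟨⟨hHG hg, hHfix g hg p hpℓ⟩, hHfix g hg y hyℓ⟩
  have horb : (t + 1) * s ≤ Nat.card {w // ∃ g ∈ stabPt G p, g.1 y = w} :=
    (hGQ.le_card_coll_ne p).trans <| Nat.card_le_card_of_injective _ <|
      Subtype.map_injective (f := id) (fun w hw =>
        hGQ.exists_mem_stabPt_apply_eq hs ht hr hEsym hE helem ⟨ℓ, hpℓ, hyℓ⟩ hyp hw.1 hw.2)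
        Function.injective_id
  have hstab := card_eq_card_orbit_mul_card_stabPt (stabPt G p) y
  have hP : Nat.card {w // ∃ g ∈ G, g.1 p = w} ≤ (s + 1) * ((t + 1) * s) :=
    (Nat.card_le_card_of_injective _ Subtype.val_injective).trans (hGQ.card_point_le hs ℓ)
  have hHs : s + 2 ≤ Nat.card H := by
    refine le_trans ?_ hHcard
    have : 1 * (s + 1) ≤ (r ^ m - 1) * (s + 1) := Nat.mul_le_mul_right _ (by omega)
    omega
  have hlt : (s + 1) * ((t + 1) * s) < Nat.card (stabPt G p) :=
    calc (s + 1) * ((t + 1) * s) < (t + 1) * s * (s + 2) := by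
          rw [mul_comm]
          exact Nat.mul_lt_mul_of_pos_left (by omega) (by positivity)
      _ ≤ Nat.card (stabPt G p) := by
          rw [hstab]
          exact Nat.mul_le_mul horb (hHs.trans hHle)
  rw [card_eq_card_orbit_mul_card_stabPt G p, sq]
  exact Nat.mul_lt_mul_of_pos_right (hP.trans_lt hlt) Nat.card_pos
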